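/- Consider minimizing the total energy E_tot(π, f_e, f_d, P) subject to T_tot(π, f_e, f_d, P) ≤ T_max, φ(π) ≥ φ_min, π_min ≤ π ≤ 1, 0 < f_e ≤ f_e^max, 0 < f_d ≤ f_d^max, 0 < P ≤ P^max. If a feasible point (π, f_e, f_d, P) satisfies T_tot(π, f_e, f_d, P) < T_max, then there exists 0 < f_e' < f_e such that (π, f_e', f_d, P) is feasible and E_tot(π, f_e', f_d, P) < E_tot(π, f_e, f_d, P). Consequently, every optimal solution of this problem satisfies T_tot = T_max. -/

import Mathlib

/-- In the FAST energy-minimization problem, any feasible point with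
slack in the latency constraint `T_tot < T_max` can be strictly improved by lowering
the encoding frequency; consequently every optimal solution satisfies `T_tot = T_max`. -/
theorem fast_latency_constraint_tight
    (K S We Wd εe εd B N0 Tmax G : ℝ)
    (hK : 0 < K) (hS : 0 < S) (hWe : 0 < We) (hWd : 0 < Wd)
    (hεe : 0 < εe) (hεd : 0 < εd) (hB : 0 < B) (hN0 : 0 < N0)
    (hTmax : 0 < Tmax) (hG : 0 < G)
    (κ1 κ2 κ3 κ4 φmin πmin femax fdmax Pmax : ℝ)
    (hκ1 : κ1 < 0) (hκ2 : 0 < κ2) (hκ3 : 0 ≤ κ3)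
    (hπmin : 0 < πmin) (hπmin1 : πmin ≤ 1)
    (hfemax : 0 < femax) (hfdmax : 0 < fdmax) (hPmax : 0 < Pmax)
    (φ : ℝ → ℝ) (hφ : ∀ p, φ p = κ1 * Real.log (κ2 / p + κ3) + κ4)
    (hφπmin : φ πmin ≤ φmin)
    (r : ℝ → ℝ) (hr : ∀ P, r P = B * Real.logb 2 (1 + G * P / (N0 * B)))
    (Ttot : ℝ → ℝ → ℝ → ℝ → ℝ)
    (hTtot : ∀ p fe fd P, Ttot p fe fd P
      = K * p ^ 2 * (We / fe + Wd / fd) + K * p * S / r P)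
    (Etot : ℝ → ℝ → ℝ → ℝ → ℝ)
    (hEtot : ∀ p fe fd P, Etot p fe fd P
      = K * p ^ 2 * (εe * fe ^ 2 * We + εd * fd ^ 2 * Wd) + P * (K * p * S / r P))
    (feasible : ℝ → ℝ → ℝ → ℝ → Prop)
    (hfeasible : ∀ p fe fd P, feasible p fe fd P ↔
      Ttot p fe fd P ≤ Tmax ∧ φmin ≤ φ p ∧ πmin ≤ p ∧ p ≤ 1 ∧
      0 < fe ∧ fe ≤ femax ∧ 0 < fd ∧ fd ≤ fdmax ∧ 0 < P ∧ P ≤ Pmax) :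
    (∀ p fe fd P, feasible p fe fd P → Ttot p fe fd P < Tmax →
      ∃ fe', 0 < fe' ∧ fe' < fe ∧ feasible p fe' fd P ∧
        Etot p fe' fd P < Etot p fe fd P) ∧
    (∀ p fe fd P, feasible p fe fd P →
      (∀ p' fe' fd' P', feasible p' fe' fd' P' →
        Etot p fe fd P ≤ Etot p' fe' fd' P') →
      Ttot p fe fd P = Tmax) := by
  have main : ∀ p fe fd P, feasible p fe fd P → Ttot p fe fd P < Tmax →
      ∃ fe', 0 < fe' ∧ fe' < fe ∧ feasible p fe' fd P ∧
        Etot p fe' fd P < Etot p fe fd P := by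
    intro p fe fd P hf hlt
    obtain ⟨-, h2, h3, h4, h5, h6, h7, h8, h9, h10⟩ := (hfeasible p fe fd P).1 hf
    have hp : 0 < p := lt_of_lt_of_le hπmin h3
    have hA : 0 < K * p ^ 2 * We := by positivity
    have hs : 0 < (Tmax - Ttot p fe fd P) / (K * p ^ 2 * We) :=
      div_pos (sub_pos.2 hlt) hA
    obtain ⟨s, hsdef⟩ : ∃ s, s = (Tmax - Ttot p fe fd P) / (K * p ^ 2 * We) := ⟨_, rfl⟩
    rw [← hsdef] at hs
    have hsA : s * (K * p ^ 2 * We) = Tmax - Ttot p fe fd P := by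
      rw [hsdef]; exact div_mul_cancel₀ _ hA.ne'
    have hinv : 0 < fe⁻¹ := inv_pos.2 h5
    have hpos : 0 < (fe⁻¹ + s)⁻¹ := inv_pos.2 (by linarith)
    have hless : (fe⁻¹ + s)⁻¹ < fe := inv_lt_of_inv_lt₀ h5 (by linarith)
    refine ⟨(fe⁻¹ + s)⁻¹, hpos, hless, ?_, ?_⟩
    · refine (hfeasible _ _ _ _).2
        ⟨?_, h2, h3, h4, hpos, hless.le.trans h6, h7, h8, h9, h10⟩
      rw [hTtot] at hsA ⊢
      rw [div_inv_eq_mul]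
      rw [div_eq_mul_inv We fe] at hsA
      linarith
    · rw [hEtot, hEtot]
      have hsq : ((fe⁻¹ + s)⁻¹) ^ 2 < fe ^ 2 := by gcongr
      gcongr
  refine ⟨main, ?_⟩
  intro p fe fd P hf hopt
  by_contra hne
  obtain ⟨fe', -, -, hf', hE⟩ :=
    main p fe fd P hf (lt_of_le_of_ne ((hfeasible p fe fd P).1 hf).1 hne)
  exact absurd (hopt _ _ _ _ hf') (not_le.2 hE)
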